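/- Let x0 ∈ 𝔇 and let x : [0,∞) → 𝔇 be differentiable with x(0) = x0, x'(t) = F(x(t)) for all t ≥ 0, and x(t) in the interior of 𝔇 for all t > 0. Then for every τ > 0, the derivative at t = τ of t ↦ L(x(t)) equals the derivative at t = τ of t ↦ Ent(x(t) / π(x(τ))), where π(x(τ)) is held fixed. -/

import Mathlib

open Filter

def simplexD (d m : ℕ) : Set (Fin m → Fin d → ℝ) :=
  {x | ∀ i, (∀ v, 0 ≤ x i v) ∧ (∑ v, x i v) = 1}

noncomputable def piMap (d m : ℕ) (α : Fin d → Fin m → Fin m → ℝ)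
    (x : Fin m → Fin d → ℝ) : Fin m → Fin d → ℝ :=
  fun i v => Real.exp (∑ j, α v i j * x j v) / ∑ u, Real.exp (∑ j, α u i j * x j u)

noncomputable def FF (d m : ℕ) (α : Fin d → Fin m → Fin m → ℝ)
    (x : Fin m → Fin d → ℝ) : Fin m → Fin d → ℝ :=
  fun i v => -(x i v) + piMap d m α x i v

noncomputable def LFun (d m : ℕ) (α : Fin d → Fin m → Fin m → ℝ)
    (x : Fin m → Fin d → ℝ) : ℝ :=
  (∑ i, ∑ v, x i v * Real.log (x i v))
    - (1 / 2) * ∑ i, ∑ j, ∑ v, α v i j * x i v * x j v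

/-- Relative entropy `Ent(x/y) = Σ_i Σ_v x_v^i log (x_v^i / y_v^i)` of two interior points
of `𝔇`. -/
noncomputable def EntD (d m : ℕ) (x y : Fin m → Fin d → ℝ) : ℝ :=
  ∑ i, ∑ v, x i v * Real.log (x i v / y i v)

theorem sum_exp_pos {d m : ℕ} (α : Fin d → Fin m → Fin m → ℝ) (x : Fin m → Fin d → ℝ)
    (i : Fin m) (v : Fin d) : 0 < ∑ u, Real.exp (∑ j, α u i j * x j u) :=
  Finset.sum_pos (fun _ _ => Real.exp_pos _) ⟨v, Finset.mem_univ v⟩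

theorem piMap_pos {d m : ℕ} (α : Fin d → Fin m → Fin m → ℝ) (x : Fin m → Fin d → ℝ)
    (i : Fin m) (v : Fin d) : 0 < piMap d m α x i v :=
  div_pos (Real.exp_pos _) (sum_exp_pos α x i v)

theorem log_piMap {d m : ℕ} (α : Fin d → Fin m → Fin m → ℝ) (x : Fin m → Fin d → ℝ)
    (i : Fin m) (v : Fin d) :
    Real.log (piMap d m α x i v) =
      (∑ j, α v i j * x j v) - Real.log (∑ u, Real.exp (∑ j, α u i j * x j u)) := by
  rw [piMap, Real.log_div (Real.exp_pos _).ne' (sum_exp_pos α x i v).ne', Real.log_exp]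

theorem sum_piMap {d m : ℕ} [NeZero d] (α : Fin d → Fin m → Fin m → ℝ)
    (x : Fin m → Fin d → ℝ) (i : Fin m) : ∑ v, piMap d m α x i v = 1 := by
  simp only [piMap]
  rw [← Finset.sum_div, div_self (sum_exp_pos α x i 0).ne']

/-- The field `FF` is tangent to the product of simplices. -/
theorem sum_FF_eq_zero {d m : ℕ} [NeZero d] (α : Fin d → Fin m → Fin m → ℝ)
    {x : Fin m → Fin d → ℝ} (hx : x ∈ simplexD d m) (i : Fin m) :
    ∑ v, FF d m α x i v = 0 := by
  simp only [FF]
  rw [Finset.sum_add_distrib, Finset.sum_neg_distrib, (hx i).2, sum_piMap]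
  ring

theorem hasDerivAt_LFun {d m : ℕ} {α : Fin d → Fin m → Fin m → ℝ}
    (hsym : ∀ v i j, α v i j = α v j i) {x : ℝ → Fin m → Fin d → ℝ}
    {x' : Fin m → Fin d → ℝ} {τ : ℝ} (hx : HasDerivAt x x' τ) (hpos : ∀ i v, 0 < x τ i v) :
    HasDerivAt (fun t => LFun d m α (x t))
      (∑ i, ∑ v, x' i v * (Real.log (x τ i v) + 1 - ∑ j, α v i j * x τ j v)) τ := by
  have hc (i : Fin m) (v : Fin d) : HasDerivAt (fun t => x t i v) (x' i v) τ :=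
    hasDerivAt_pi.1 (hasDerivAt_pi.1 hx i) v
  have hlog : HasDerivAt (fun t => ∑ i, ∑ v, x t i v * Real.log (x t i v))
      (∑ i, ∑ v, (x' i v * Real.log (x τ i v) + x τ i v * (x' i v / x τ i v))) τ :=
    HasDerivAt.fun_sum fun i _ => HasDerivAt.fun_sum fun v _ =>
      (hc i v).mul ((hc i v).log (hpos i v).ne')
  have hquad : HasDerivAt (fun t => ∑ i, ∑ j, ∑ v, α v i j * x t i v * x t j v)
      (∑ i, ∑ j, ∑ v, (α v i j * x' i v * x τ j v + α v i j * x τ i v * x' j v)) τ :=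
    HasDerivAt.fun_sum fun i _ => HasDerivAt.fun_sum fun j _ => HasDerivAt.fun_sum fun v _ =>
      ((hc i v).const_mul (α v i j)).mul (hc j v)
  have hswap : ∑ i, ∑ j, ∑ v, α v i j * x τ i v * x' j v =
      ∑ i, ∑ j, ∑ v, α v i j * x' i v * x τ j v := by
    rw [Finset.sum_comm]
    refine Finset.sum_congr rfl fun i _ => Finset.sum_congr rfl fun j _ =>
      Finset.sum_congr rfl fun v _ => ?_
    rw [hsym v j i]
    ring
  have hreorder : ∑ i, ∑ j, ∑ v, α v i j * x' i v * x τ j v =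
      ∑ i, ∑ v, x' i v * ∑ j, α v i j * x τ j v := by
    refine Finset.sum_congr rfl fun i _ => ?_
    rw [Finset.sum_comm]
    refine Finset.sum_congr rfl fun v _ => ?_
    rw [Finset.mul_sum]
    exact Finset.sum_congr rfl fun j _ => by ring
  refine (hlog.sub (hquad.const_mul (1 / 2))).congr_deriv ?_
  simp only [Finset.sum_add_distrib] at hswap ⊢
  rw [hswap, hreorder, ← two_mul, ← mul_assoc, one_div, inv_mul_cancel₀ two_ne_zero, one_mul]
  simp only [← Finset.sum_add_distrib, ← Finset.sum_sub_distrib]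
  refine Finset.sum_congr rfl fun i _ => Finset.sum_congr rfl fun v _ => ?_
  rw [mul_div_cancel₀ _ (hpos i v).ne']
  ring

theorem hasDerivAt_EntD {d m : ℕ} {x : ℝ → Fin m → Fin d → ℝ} {x' y : Fin m → Fin d → ℝ}
    {τ : ℝ} (hx : HasDerivAt x x' τ) (hpos : ∀ i v, 0 < x τ i v) (hy : ∀ i v, 0 < y i v) :
    HasDerivAt (fun t => EntD d m (x t) y)
      (∑ i, ∑ v, x' i v * (Real.log (x τ i v) + 1 - Real.log (y i v))) τ := by
  have hc (i : Fin m) (v : Fin d) : HasDerivAt (fun t => x t i v) (x' i v) τ :=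
    hasDerivAt_pi.1 (hasDerivAt_pi.1 hx i) v
  refine HasDerivAt.fun_sum fun i _ => HasDerivAt.fun_sum fun v _ => ?_
  have hxne := (hpos i v).ne'
  have hyne := (hy i v).ne'
  refine ((hc i v).mul (((hc i v).div_const (y i v)).log (div_ne_zero hxne hyne))).congr_deriv ?_
  rw [Real.log_div hxne hyne]
  field_simp
  ring

/-- Along a solution of `x' = F(x)` lying in the interior of `𝔇` for `t > 0`, for every
`τ > 0` the derivative at `t = τ` of `t ↦ L(x(t))` equals the derivative at `t = τ` of
`t ↦ Ent(x(t) / π(x(τ)))`, with `π(x(τ))` held fixed. -/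
theorem deriv_L_eq_deriv_Ent (d m : ℕ) (hd : 2 ≤ d) (hm : 2 ≤ m)
    (α : Fin d → Fin m → Fin m → ℝ) (hsym : ∀ v i j, α v i j = α v j i)
    (x0 : Fin m → Fin d → ℝ) (hx0mem : x0 ∈ simplexD d m)
    (x : ℝ → Fin m → Fin d → ℝ) (hx0 : x 0 = x0)
    (hmem : ∀ t, 0 ≤ t → x t ∈ simplexD d m)
    (hder : ∀ t, 0 ≤ t → HasDerivAt x (FF d m α (x t)) t)
    (hint : ∀ t, 0 < t → ∀ i v, 0 < x t i v) :
    ∀ τ, 0 < τ →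
      deriv (fun t => LFun d m α (x t)) τ
        = deriv (fun t => EntD d m (x t) (piMap d m α (x τ))) τ := by
  intro τ hτ
  have : NeZero d := ⟨by omega⟩
  have hd' := hder τ hτ.le
  rw [(hasDerivAt_LFun hsym hd' (hint τ hτ)).deriv,
    (hasDerivAt_EntD hd' (hint τ hτ) (piMap_pos α (x τ))).deriv]
  refine Finset.sum_congr rfl fun i _ => ?_
  simp only [log_piMap]
  rw [← sub_eq_zero, ← Finset.sum_sub_distrib]
  calc
    _ = ∑ v, FF d m α (x τ) i v *
        -Real.log (∑ u, Real.exp (∑ j, α u i j * x τ j u)) :=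
      Finset.sum_congr rfl fun v _ => by ring
    _ = 0 := by rw [← Finset.sum_mul, sum_FF_eq_zero α (hmem τ hτ.le), zero_mul]
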